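/- Let Z ⊆ ℝ^d_z, let P_Z be a Borel probability measure on Z, let Φ be a nonempty index set with measurable maps f_φ : ℝ^d → ℝ^m, let g : ℝ^p × Z → ℝ^d with each g_θ := g(θ,·) measurable, and let P_X be a Borel probability measure on ℝ^d. Fix θ ∈ ℝ^p and assume there is L(θ,·) : Z → ℝ with ∫ L(θ,z) dP_Z(z) < ∞ and, for each z, an open neighborhood U_z of θ such that ‖f_φ(g(θ,z)) − f_φ(g(θ',z))‖ ≤ L(θ,z)·‖θ − θ'‖ for all θ' ∈ U_z and all φ ∈ Φ; assume moreover there is a single open neighborhood U of θ contained in all U_z. Then for all θ' ∈ U, |sup_{φ ∈ Φ} M_{f_φ}(P_X, (g_θ)_*P_Z) − sup_{φ ∈ Φ} M_{f_φ}(P_X, (g_{θ'})_*P_Z)| ≤ 4 (∫ L(θ,z) dP_Z(z)) · ‖θ − θ'‖; in particular θ ↦ sup_{φ ∈ Φ} M_{f_φ}(P_X, (g_θ)_*P_Z) is locally Lipschitz. -/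

import Mathlib

open MeasureTheory Real

/-- Squared MMD with the Gaussian kernel composed with `f`. -/
noncomputable def sqMMD {d m : ℕ} (f : EuclideanSpace ℝ (Fin d) → EuclideanSpace ℝ (Fin m))
    (P Q : Measure (EuclideanSpace ℝ (Fin d))) : ℝ :=
  (∫ x, ∫ x', Real.exp (-‖f x - f x'‖ ^ 2) ∂P ∂P)
    - 2 * (∫ x, ∫ y, Real.exp (-‖f x - f y‖ ^ 2) ∂Q ∂P)
    + (∫ y, ∫ y', Real.exp (-‖f y - f y'‖ ^ 2) ∂Q ∂Q)


lemma aux_exp_sq_lip (a b : ℝ) : |Real.exp (-a ^ 2) - Real.exp (-b ^ 2)| ≤ |a - b| := by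
  have hd : ∀ x ∈ (Set.univ : Set ℝ), HasDerivWithinAt (fun t : ℝ => Real.exp (-t ^ 2))
      (Real.exp (-x ^ 2) * (-(2 * x))) Set.univ x := by
    intro x _
    have h1 : HasDerivAt (fun t : ℝ => -t ^ 2) (-(2 * x)) x := by
      have h0 := (hasDerivAt_pow 2 x).neg
      refine (h0.congr_deriv (by simp)).congr_of_eventuallyEq ?_
      exact Filter.Eventually.of_forall fun t => rfl
    exact h1.exp.hasDerivWithinAt
  have hb : ∀ x ∈ (Set.univ : Set ℝ), ‖Real.exp (-x ^ 2) * (-(2 * x))‖ ≤ 1 := by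
    intro x _
    rw [norm_mul, Real.norm_eq_abs, Real.norm_eq_abs, Real.abs_exp, abs_neg, Real.exp_neg,
      inv_mul_le_iff₀ (Real.exp_pos _), mul_one]
    have h2 := Real.add_one_le_exp (x ^ 2)
    refine le_trans ?_ h2
    rw [abs_le]
    constructor <;> nlinarith [sq_nonneg (x - 1), sq_nonneg (x + 1)]
  have := convex_univ.norm_image_sub_le_of_norm_hasDerivWithin_le hd hb
    (Set.mem_univ b) (Set.mem_univ a)
  simpa [Real.norm_eq_abs] using this

section aux
variable {A B E : Type*} [MeasurableSpace A] [MeasurableSpace B]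
  [NormedAddCommGroup E] [MeasurableSpace E] [BorelSpace E] [SecondCountableTopology E]

lemma aux_meas (u : A → E) (v : B → E) (hu : Measurable u) (hv : Measurable v) :
    Measurable (fun q : A × B => Real.exp (-‖u q.1 - v q.2‖ ^ 2)) := by
  fun_prop

lemma aux_bound (x : E) : ‖Real.exp (-‖x‖ ^ 2)‖ ≤ 1 := by
  rw [Real.norm_eq_abs, Real.abs_exp, Real.exp_le_one_iff]
  have := sq_nonneg ‖x‖
  linarith

lemma aux_int_in (ν : Measure B) [IsProbabilityMeasure ν] (c : E) (v : B → E)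
    (hv : Measurable v) : Integrable (fun y => Real.exp (-‖c - v y‖ ^ 2)) ν := by
  refine Integrable.of_bound (C := 1) ?_ (Filter.Eventually.of_forall fun y => aux_bound _)
  exact Measurable.aestronglyMeasurable (by fun_prop)

lemma aux_norm_in (ν : Measure B) [IsProbabilityMeasure ν] (c : E) (v : B → E) :
    ‖∫ y, Real.exp (-‖c - v y‖ ^ 2) ∂ν‖ ≤ 1 := by
  have := norm_integral_le_of_norm_le_const (μ := ν) (f := fun y => Real.exp (-‖c - v y‖ ^ 2))
    (C := 1) (Filter.Eventually.of_forall fun y => aux_bound _)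
  simpa using this

lemma aux_sm (ν : Measure B) [IsProbabilityMeasure ν] (u : A → E) (v : B → E)
    (hu : Measurable u) (hv : Measurable v) :
    StronglyMeasurable (fun x => ∫ y, Real.exp (-‖u x - v y‖ ^ 2) ∂ν) :=
  (aux_meas u v hu hv).stronglyMeasurable.integral_prod_right

lemma aux_int_out (μ : Measure A) [IsProbabilityMeasure μ]
    (ν : Measure B) [IsProbabilityMeasure ν] (u : A → E) (v : B → E)
    (hu : Measurable u) (hv : Measurable v) :
    Integrable (fun x => ∫ y, Real.exp (-‖u x - v y‖ ^ 2) ∂ν) μ :=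
  Integrable.of_bound (C := 1) (aux_sm ν u v hu hv).aestronglyMeasurable
    (Filter.Eventually.of_forall fun _ => aux_norm_in _ _ _)

lemma aux_norm_out (μ : Measure A) [IsProbabilityMeasure μ]
    (ν : Measure B) [IsProbabilityMeasure ν] (u : A → E) (v : B → E) :
    |∫ x, ∫ y, Real.exp (-‖u x - v y‖ ^ 2) ∂ν ∂μ| ≤ 1 := by
  have := norm_integral_le_of_norm_le_const (μ := μ)
    (f := fun x => ∫ y, Real.exp (-‖u x - v y‖ ^ 2) ∂ν)
    (C := 1) (Filter.Eventually.of_forall fun _ => aux_norm_in _ _ _)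
  simpa using this

lemma aux_diff (μ : Measure A) [IsProbabilityMeasure μ]
    (ν : Measure B) [IsProbabilityMeasure ν] (u u' : A → E) (v v' : B → E)
    (hu : Measurable u) (hv : Measurable v) (hu' : Measurable u') (hv' : Measurable v')
    (l : A → ℝ) (r : B → ℝ) (hl : Integrable l μ) (hr : Integrable r ν)
    (hul : ∀ x, ‖u x - u' x‖ ≤ l x) (hvr : ∀ y, ‖v y - v' y‖ ≤ r y) :
    |(∫ x, ∫ y, Real.exp (-‖u x - v y‖ ^ 2) ∂ν ∂μ)
      - ∫ x, ∫ y, Real.exp (-‖u' x - v' y‖ ^ 2) ∂ν ∂μ| ≤ (∫ x, l x ∂μ) + ∫ y, r y ∂ν := by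
  have hin : ∀ x, ‖(∫ y, Real.exp (-‖u x - v y‖ ^ 2) ∂ν)
      - ∫ y, Real.exp (-‖u' x - v' y‖ ^ 2) ∂ν‖ ≤ l x + ∫ y, r y ∂ν := by
    intro x
    rw [← integral_sub (aux_int_in ν _ v hv) (aux_int_in ν _ v' hv')]
    have h := norm_integral_le_of_norm_le (μ := ν)
      (f := fun y => Real.exp (-‖u x - v y‖ ^ 2) - Real.exp (-‖u' x - v' y‖ ^ 2))
      (g := fun y => l x + r y) ((integrable_const _).add hr)
      (Filter.Eventually.of_forall fun y => by
        refine (aux_exp_sq_lip _ _).trans ((abs_norm_sub_norm_le _ _).trans ?_)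
        have e : u x - v y - (u' x - v' y) = (u x - u' x) - (v y - v' y) := by abel
        rw [e]
        exact (norm_sub_le _ _).trans (add_le_add (hul x) (hvr y)))
    rw [integral_add (integrable_const _) hr] at h
    simpa using h
  rw [← integral_sub (aux_int_out μ ν u v hu hv) (aux_int_out μ ν u' v' hu' hv')]
  have h := norm_integral_le_of_norm_le (hl.add (integrable_const (∫ y, r y ∂ν)))
    (Filter.Eventually.of_forall hin)
  simp only [Pi.add_apply] at h
  rw [integral_add hl (integrable_const _)] at h
  simpa using h

end aux

lemma aux_sqMMD_map {Z : Type*} [MeasurableSpace Z] (PZ : Measure Z) [IsProbabilityMeasure PZ]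
    {d m : ℕ} (f : EuclideanSpace ℝ (Fin d) → EuclideanSpace ℝ (Fin m)) (hf : Measurable f)
    (P : Measure (EuclideanSpace ℝ (Fin d))) [IsProbabilityMeasure P]
    (a : Z → EuclideanSpace ℝ (Fin d)) (ha : Measurable a) :
    sqMMD f P (PZ.map a) = (∫ x, ∫ x', Real.exp (-‖f x - f x'‖ ^ 2) ∂P ∂P)
    - 2 * (∫ x, ∫ z, Real.exp (-‖f x - f (a z)‖ ^ 2) ∂PZ ∂P)
    + (∫ z, ∫ z', Real.exp (-‖f (a z) - f (a z')‖ ^ 2) ∂PZ ∂PZ) := by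
  have hin : ∀ c, ∫ y, Real.exp (-‖c - f y‖ ^ 2) ∂(PZ.map a)
      = ∫ z, Real.exp (-‖c - f (a z)‖ ^ 2) ∂PZ := fun c =>
    integral_map ha.aemeasurable (Measurable.aestronglyMeasurable (by fun_prop))
  unfold sqMMD
  simp only [hin]
  rw [integral_map ha.aemeasurable
    (aux_sm PZ f (fun z => f (a z)) hf (hf.comp ha)).aestronglyMeasurable]

/-- Local Lipschitz bound for `θ ↦ sup_φ M_{f_φ}(P_X, (g_θ)_* P_Z)`: under the local
Lipschitz assumption at a fixed `θ`, with a uniform open neighborhood `U` contained in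
all the neighborhoods `Uz z`, for all `θ' ∈ U` we have
`|sup_φ M_{f_φ}(P_X,(g_θ)_*P_Z) - sup_φ M_{f_φ}(P_X,(g_{θ'})_*P_Z)|
  ≤ 4 (∫ L(θ,z) dP_Z) ‖θ - θ'‖`. -/
theorem abs_sup_sqMMD_sub_le_of_locally_lipschitz
    {dz p d m : ℕ} (Z : Set (EuclideanSpace ℝ (Fin dz)))
    (PZ : Measure Z) [IsProbabilityMeasure PZ]
    {Φ : Type*} [Nonempty Φ]
    (fφ : Φ → EuclideanSpace ℝ (Fin d) → EuclideanSpace ℝ (Fin m))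
    (hfφ : ∀ φ, Measurable (fφ φ))
    (g : EuclideanSpace ℝ (Fin p) × Z → EuclideanSpace ℝ (Fin d))
    (hg : ∀ θ, Measurable fun z => g (θ, z))
    (PX : Measure (EuclideanSpace ℝ (Fin d))) [IsProbabilityMeasure PX]
    (θ : EuclideanSpace ℝ (Fin p))
    (L : Z → ℝ) (hL : Integrable L PZ)
    (Uz : Z → Set (EuclideanSpace ℝ (Fin p)))
    (hUz_open : ∀ z, IsOpen (Uz z)) (hUz_mem : ∀ z, θ ∈ Uz z)
    (hLip : ∀ z, ∀ θ' ∈ Uz z, ∀ φ,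
      ‖fφ φ (g (θ, z)) - fφ φ (g (θ', z))‖ ≤ L z * ‖θ - θ'‖)
    (U : Set (EuclideanSpace ℝ (Fin p))) (hU_open : IsOpen U) (hU_mem : θ ∈ U)
    (hU_sub : ∀ z, U ⊆ Uz z) :
    ∀ θ' ∈ U,
      |(⨆ φ, sqMMD (fφ φ) PX (PZ.map fun z => g (θ, z))) -
        (⨆ φ, sqMMD (fφ φ) PX (PZ.map fun z => g (θ', z)))| ≤
      4 * (∫ z, L z ∂PZ) * ‖θ - θ'‖ := by
  intro θ' hθ'
  have hl : Integrable (fun z => L z * ‖θ - θ'‖) PZ := hL.mul_const _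
  have hb : ∀ t, BddAbove (Set.range fun φ => sqMMD (fφ φ) PX (PZ.map fun z => g (t, z))) := by
    intro t
    refine ⟨4, ?_⟩
    rintro _ ⟨φ, rfl⟩
    simp only
    rw [aux_sqMMD_map PZ _ (hfφ φ) PX _ (hg t)]
    have h1 := abs_le.1 (aux_norm_out PX PX (fφ φ) (fφ φ))
    have h2 := abs_le.1 (aux_norm_out PX PZ (fφ φ) (fun z => fφ φ (g (t, z))))
    have h3 := abs_le.1 (aux_norm_out PZ PZ (fun z => fφ φ (g (t, z)))
      (fun z => fφ φ (g (t, z))))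
    linarith [h1.2, h2.1, h3.2]
  have key : ∀ φ, |sqMMD (fφ φ) PX (PZ.map fun z => g (θ, z))
      - sqMMD (fφ φ) PX (PZ.map fun z => g (θ', z))| ≤ 4 * (∫ z, L z ∂PZ) * ‖θ - θ'‖ := by
    intro φ
    rw [aux_sqMMD_map PZ _ (hfφ φ) PX _ (hg θ), aux_sqMMD_map PZ _ (hfφ φ) PX _ (hg θ')]
    have m1 := (hfφ φ).comp (hg θ)
    have m2 := (hfφ φ).comp (hg θ')
    have hd := fun z => hLip z θ' (hU_sub z hθ') φ
    have h2 := abs_le.1 (aux_diff PX PZ (fφ φ) (fφ φ) _ _ (hfφ φ) m1 (hfφ φ) m2 (fun _ => 0) _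
      (integrable_zero _ _ _) hl (by simp) hd)
    have h3 := abs_le.1 (aux_diff PZ PZ _ _ _ _ m1 m1 m2 m2 _ _ hl hl hd hd)
    simp only [integral_mul_const, integral_zero, Function.comp] at h2 h3
    rw [abs_le]
    constructor <;> linarith [h2.1, h2.2, h3.1, h3.2]
  rw [abs_sub_le_iff]
  constructor
  · rw [sub_le_iff_le_add]
    refine ciSup_le fun φ => ?_
    have := le_ciSup (hb θ') φ
    linarith [(abs_le.1 (key φ)).2]
  · rw [sub_le_iff_le_add]
    refine ciSup_le fun φ => ?_
    have := le_ciSup (hb θ) φ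
    linarith [(abs_le.1 (key φ)).1]
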